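/- Let α be a nonnegative integer and w > 0. Define u_α(ξ) = Σ_{k≥0} (-1)^k α! ξ^k / (4^k k! (k+α)!), and for z > 0 set ỹ(z) = ∫_0^{ln(z/w)} u_α(z^2 + w^2 - 2zw cosh ζ) (sinh ζ)^{2α} dζ. Then ỹ is twice differentiable on (0,∞) and satisfies, for all z > 0, z ỹ''(z) + (2α+1) ỹ'(z) + z ỹ(z) = (α / (2^{2α-2} w^{2α})) · ((z^2 - w^2)/z)^{2α-1}, where for α = 0 the right-hand side is 0. -/

import Mathlib

/-- The entire function `u_α` with `u_α(x²) = j_α(x)`: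
`u_α(ξ) = Σ_{k≥0} (-1)^k α! ξ^k / (4^k k! (k+α)!)`. -/
noncomputable def uBessel (α : ℕ) (ξ : ℝ) : ℝ :=
  ∑' k : ℕ, (-1 : ℝ) ^ k * (Nat.factorial α : ℝ) * ξ ^ k /
    ((4 : ℝ) ^ k * (Nat.factorial k : ℝ) * (Nat.factorial (k + α) : ℝ))

open Filter Topology intervalIntegral

theorem summable_uBessel_term (α : ℕ) (ξ : ℝ) :
    Summable fun k : ℕ => (-1 : ℝ) ^ k * (Nat.factorial α : ℝ) * ξ ^ k /
      ((4 : ℝ) ^ k * (Nat.factorial k : ℝ) * (Nat.factorial (k + α) : ℝ)) := by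
  refine Summable.of_norm_bounded (Real.summable_pow_div_factorial |ξ|) fun k => ?_
  have h1 : (Nat.factorial α : ℝ) ≤ Nat.factorial (k + α) := by
    exact_mod_cast Nat.factorial_le (Nat.le_add_left α k)
  have h4 : (1 : ℝ) ≤ 4 ^ k := one_le_pow₀ (by norm_num)
  have hk : (0 : ℝ) < Nat.factorial k := by positivity
  have hα : (0 : ℝ) < Nat.factorial (k + α) := by positivity
  simp only [norm_div, norm_mul, norm_pow, norm_neg, norm_one, one_pow, one_mul, Real.norm_eq_abs,
    Nat.abs_cast, Nat.abs_ofNat]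
  rw [div_le_div_iff₀ (by positivity) hk]
  calc (Nat.factorial α : ℝ) * |ξ| ^ k * Nat.factorial k
      ≤ (4 ^ k * Nat.factorial (k + α)) * |ξ| ^ k * Nat.factorial k := by
        gcongr
        nlinarith
    _ = |ξ| ^ k * (4 ^ k * Nat.factorial k * Nat.factorial (k + α)) := by ring

/-- The derivative of `u_α` is `-u_{α+1} / (4 (α + 1))`. -/
theorem hasDerivAt_uBessel (α : ℕ) (ξ : ℝ) :
    HasDerivAt (uBessel α) (-1 / (4 * ((α : ℝ) + 1)) * uBessel (α + 1) ξ) ξ := by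
  set g' : ℕ → ℝ → ℝ := fun k y => (-1 : ℝ) ^ k * (Nat.factorial α : ℝ) * (k * y ^ (k - 1)) /
      ((4 : ℝ) ^ k * (Nat.factorial k : ℝ) * (Nat.factorial (k + α) : ℝ)) with hg'
  have hsucc : ∀ (k : ℕ) (y : ℝ), g' (k + 1) y = -1 / (4 * ((α : ℝ) + 1)) *
      ((-1 : ℝ) ^ k * (Nat.factorial (α + 1) : ℝ) * y ^ k /
      ((4 : ℝ) ^ k * (Nat.factorial k : ℝ) * (Nat.factorial (k + (α + 1)) : ℝ))) := by
    intro k y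
    have hk : (Nat.factorial k : ℝ) ≠ 0 := by positivity
    have hα : (Nat.factorial (k + 1 + α) : ℝ) ≠ 0 := by positivity
    have ha1 : ((α : ℝ) + 1) ≠ 0 := by positivity
    have hk1 : ((k : ℝ) + 1) ≠ 0 := by positivity
    simp only [hg', show k + (α + 1) = k + 1 + α by ring, Nat.factorial_succ k,
      Nat.factorial_succ α, Nat.add_sub_cancel]
    push_cast
    field_simp
    ring
  have hsum : Summable fun k => g' k (|ξ| + 1) := by
    rw [← summable_nat_add_iff 1]
    simp only [hsucc]
    exact (summable_uBessel_term (α + 1) (|ξ| + 1)).mul_left _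
  have key := hasDerivAt_tsum_of_isPreconnected (𝕜 := ℝ)
    (g := fun (k : ℕ) (y : ℝ) => (-1 : ℝ) ^ k * (Nat.factorial α : ℝ) * y ^ k /
      ((4 : ℝ) ^ k * (Nat.factorial k : ℝ) * (Nat.factorial (k + α) : ℝ)))
    (g' := g') (t := Metric.ball 0 (|ξ| + 1)) (y := ξ) (y₀ := 0) hsum.norm Metric.isOpen_ball
    (convex_ball _ _).isPreconnected
    (fun k y _ => ((hasDerivAt_pow k y).const_mul _).div_const _) ?_
    (Metric.mem_ball_self (by positivity)) (summable_uBessel_term α 0) (by simp)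
  · refine key.congr_deriv ?_
    rw [(Summable.of_norm_bounded (g := fun k => ‖g' k (|ξ| + 1)‖) hsum.norm ?_).tsum_eq_zero_add]
    · simp only [hsucc, tsum_mul_left, uBessel]
      simp [hg']
    · intro k
      simp only [hg', norm_div, norm_mul, norm_pow, Real.norm_eq_abs]
      rw [abs_of_nonneg (show (0 : ℝ) ≤ |ξ| + 1 by positivity)]
      gcongr
      linarith
  · intro k y hy
    have hy' : |y| < |ξ| + 1 := by simpa using hy
    simp only [hg', norm_div, norm_mul, norm_pow, Real.norm_eq_abs]
    rw [abs_of_nonneg (show (0 : ℝ) ≤ |ξ| + 1 by positivity)]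
    gcongr

theorem continuous_uBessel (α : ℕ) : Continuous (uBessel α) :=
  continuous_iff_continuousAt.2 fun ξ => (hasDerivAt_uBessel α ξ).continuousAt

@[simp]
theorem uBessel_zero (α : ℕ) : uBessel α 0 = 1 := by
  unfold uBessel
  rw [tsum_eq_single 0 (fun k hk => by simp [hk])]
  have hα : (Nat.factorial α : ℝ) ≠ 0 := by positivity
  simp [hα]

/-- Contiguity relation, equivalent to the Bessel equation `ξ u'' + (α + 1) u' + u / 4 = 0`. -/
theorem uBessel_contiguity (α : ℕ) (ξ : ℝ) :
    ξ * uBessel (α + 2) ξ = 4 * ((α : ℝ) + 1) * (α + 2) * (uBessel (α + 1) ξ - uBessel α ξ) := by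
  have h0 := summable_uBessel_term α ξ
  have h1 := summable_uBessel_term (α + 1) ξ
  unfold uBessel
  rw [h0.tsum_eq_zero_add, h1.tsum_eq_zero_add]
  have e0 := (summable_nat_add_iff 1).2 h0
  have e1 := (summable_nat_add_iff 1).2 h1
  have hα : (Nat.factorial α : ℝ) ≠ 0 := by positivity
  have hα1 : (Nat.factorial (α + 1) : ℝ) ≠ 0 := by positivity
  have hz : ∀ β : ℕ, (-1 : ℝ) ^ 0 * (Nat.factorial β : ℝ) * ξ ^ 0 /
      ((4 : ℝ) ^ 0 * (Nat.factorial 0 : ℝ) * (Nat.factorial (0 + β) : ℝ)) = 1 := by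
    intro β
    have : (Nat.factorial β : ℝ) ≠ 0 := by positivity
    simp [this]
  rw [hz, hz, add_sub_add_left_eq_sub, ← e1.tsum_sub e0, ← tsum_mul_left, ← tsum_mul_left]
  refine tsum_congr fun k => ?_
  have hk : (Nat.factorial k : ℝ) ≠ 0 := by positivity
  have hkα : (Nat.factorial (k + 1 + α) : ℝ) ≠ 0 := by positivity
  have hk1 : ((k : ℝ) + 1) ≠ 0 := by positivity
  have hk2 : ((k : ℝ) + 1 + α + 1) ≠ 0 := by positivity
  simp only [show k + (α + 2) = k + 1 + α + 1 by ring, show k + 1 + (α + 1) = k + 1 + α + 1 by ring,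
    Nat.factorial_succ k, Nat.factorial_succ α, Nat.factorial_succ (α + 1),
    Nat.factorial_succ (k + 1 + α)]
  push_cast
  field_simp
  ring

/-- Leibniz rule for an integral with a variable upper limit. -/
theorem hasDerivAt_integral_variable_limit {F F' : ℝ → ℝ → ℝ} {b : ℝ → ℝ} {a z b' : ℝ}
    (hF : Continuous (Function.uncurry F)) (hF' : Continuous (Function.uncurry F'))
    (hd : ∀ x t, HasDerivAt (fun x => F x t) (F' x t) x) (hb : HasDerivAt b b' z) :
    HasDerivAt (fun x => ∫ t in a..b x, F x t)
      ((∫ t in a..b z, F' z t) + F z (b z) * b') z := by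
  have cF : ∀ x, Continuous (F x) := fun x => hF.comp (by fun_prop : Continuous fun t => (x, t))
  have cF' : ∀ x, Continuous (F' x) := fun x => hF'.comp (by fun_prop : Continuous fun t => (x, t))
  have d1 : ∀ x c, HasDerivAt (fun x => ∫ t in a..c, F x t) (∫ t in a..c, F' x t) x := by
    intro x c
    obtain ⟨C, hC⟩ := IsCompact.exists_bound_of_continuousOn
      ((isCompact_closedBall x 1).prod (isCompact_uIcc (a := a) (b := c))) hF'.continuousOn
    refine (intervalIntegral.hasDerivAt_integral_of_dominated_loc_of_deriv_le
      (s := Metric.closedBall x 1) (bound := fun _ => C)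
      (Metric.closedBall_mem_nhds x one_pos) (Eventually.of_forall fun y =>
        (cF y).aestronglyMeasurable) ((cF x).intervalIntegrable _ _)
        (cF' x).aestronglyMeasurable ?_ (by simp) ?_).2
    · exact Eventually.of_forall fun t ht y hy => hC (y, t) ⟨hy, Set.uIoc_subset_uIcc ht⟩
    · exact Eventually.of_forall fun t _ y _ => hd y t
  have d2 : ∀ x c, HasDerivAt (fun c => ∫ t in a..c, F x t) (F x c) c := fun x c =>
    integral_hasDerivAt_right ((cF x).intervalIntegrable _ _)
      ((cF x).stronglyMeasurableAtFilter _ _) (cF x).continuousAt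
  have cI : Continuous fun p : ℝ × ℝ => ∫ t in a..p.2, F' p.1 t :=
    continuous_parametric_intervalIntegral_of_continuous
      (f := fun (p : ℝ × ℝ) t => F' p.1 t)
      (hF'.comp (by fun_prop : Continuous fun q : (ℝ × ℝ) × ℝ => (q.1.1, q.2))) continuous_snd
  have key := hasStrictFDerivAt_uncurry_coprod (𝕜 := ℝ) (u := (z, b z))
    (f := fun x c => ∫ t in a..c, F x t)
    (f₁ := fun x c => ContinuousLinearMap.toSpanSingleton ℝ (∫ t in a..c, F' x t))
    (f₂ := fun x c => ContinuousLinearMap.toSpanSingleton ℝ (F x c))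
    (Eventually.of_forall fun v => (d1 v.1 v.2).hasFDerivAt)
    (Eventually.of_forall fun v => (d2 v.1 v.2).hasFDerivAt)
    ((ContinuousLinearMap.toSpanSingletonCLE (𝕜 := ℝ) (E := ℝ)).continuous.comp cI).continuousAt
    ((ContinuousLinearMap.toSpanSingletonCLE (𝕜 := ℝ) (E := ℝ)).continuous.comp hF).continuousAt
  have := key.hasFDerivAt.comp_hasDerivAt z ((hasDerivAt_id z).prodMk hb)
  refine this.congr_deriv ?_
  simp [Function.HasUncurry.uncurry, mul_comm]

/-- The argument `z² + w² - 2zw cosh ζ` of `u_α` in the integrand of `ỹ`. -/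
noncomputable def kernelArg (w z ζ : ℝ) : ℝ := z ^ 2 + w ^ 2 - 2 * z * w * Real.cosh ζ

/-- The integrand of `ỹ`. -/
noncomputable def kernel (α : ℕ) (w z ζ : ℝ) : ℝ :=
  uBessel α (kernelArg w z ζ) * Real.sinh ζ ^ (2 * α)

/-- The first `z`-derivative of `kernel`. -/
noncomputable def kernelDeriv (α : ℕ) (w z ζ : ℝ) : ℝ :=
  -1 / (4 * ((α : ℝ) + 1)) * uBessel (α + 1) (kernelArg w z ζ) *
    (2 * z - 2 * w * Real.cosh ζ) * Real.sinh ζ ^ (2 * α)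

/-- The second `z`-derivative of `kernel`. -/
noncomputable def kernelDeriv₂ (α : ℕ) (w z ζ : ℝ) : ℝ :=
  (-1 / (4 * ((α : ℝ) + 1)) * (-1 / (4 * ((α : ℝ) + 2)) * uBessel (α + 2) (kernelArg w z ζ) *
    (2 * z - 2 * w * Real.cosh ζ)) * (2 * z - 2 * w * Real.cosh ζ) +
    -1 / (4 * ((α : ℝ) + 1)) * uBessel (α + 1) (kernelArg w z ζ) * 2) * Real.sinh ζ ^ (2 * α)

theorem hasDerivAt_uBessel_succ (α : ℕ) (ξ : ℝ) :
    HasDerivAt (uBessel (α + 1)) (-1 / (4 * ((α : ℝ) + 2)) * uBessel (α + 2) ξ) ξ := by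
  refine (hasDerivAt_uBessel (α + 1) ξ).congr_deriv ?_
  push_cast
  ring_nf

theorem hasDerivAt_kernelArg (w z ζ : ℝ) :
    HasDerivAt (fun z => kernelArg w z ζ) (2 * z - 2 * w * Real.cosh ζ) z := by
  have := (((hasDerivAt_pow 2 z).add_const (w ^ 2)).sub
    ((((hasDerivAt_id z).const_mul 2).mul_const w).mul_const (Real.cosh ζ)))
  exact this.congr_deriv (by simp)

theorem continuous_kernelArg (w : ℝ) : Continuous fun p : ℝ × ℝ => kernelArg w p.1 p.2 := by
  unfold kernelArg
  fun_prop

theorem continuous_uBessel_kernelArg (β : ℕ) (w : ℝ) :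
    Continuous fun p : ℝ × ℝ => uBessel β (kernelArg w p.1 p.2) :=
  (continuous_uBessel β).comp (continuous_kernelArg w)

theorem continuous_kernel (α : ℕ) (w : ℝ) : Continuous (Function.uncurry (kernel α w)) := by
  have := continuous_uBessel_kernelArg α w
  simp only [Function.uncurry_def, kernel]
  fun_prop

theorem continuous_kernelDeriv (α : ℕ) (w : ℝ) :
    Continuous (Function.uncurry (kernelDeriv α w)) := by
  have := continuous_uBessel_kernelArg (α + 1) w
  simp only [Function.uncurry_def, kernelDeriv]
  fun_prop

theorem continuous_kernelDeriv₂ (α : ℕ) (w : ℝ) :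
    Continuous (Function.uncurry (kernelDeriv₂ α w)) := by
  have := continuous_uBessel_kernelArg (α + 1) w
  have := continuous_uBessel_kernelArg (α + 2) w
  simp only [Function.uncurry_def, kernelDeriv₂]
  fun_prop

theorem hasDerivAt_kernel (α : ℕ) (w z ζ : ℝ) :
    HasDerivAt (fun z => kernel α w z ζ) (kernelDeriv α w z ζ) z :=
  ((hasDerivAt_uBessel α (kernelArg w z ζ)).comp z (hasDerivAt_kernelArg w z ζ)).mul_const _

theorem hasDerivAt_kernelDeriv (α : ℕ) (w z ζ : ℝ) :
    HasDerivAt (fun z => kernelDeriv α w z ζ) (kernelDeriv₂ α w z ζ) z := by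
  have hL : HasDerivAt (fun z => 2 * z - 2 * w * Real.cosh ζ) 2 z :=
    (((hasDerivAt_id z).const_mul 2).sub_const _).congr_deriv (by simp)
  exact ((((hasDerivAt_uBessel_succ α (kernelArg w z ζ)).comp z
    (hasDerivAt_kernelArg w z ζ)).const_mul _).mul hL).mul_const _

/-- The Bessel operator in `z` applied to `kernel` is an exact derivative in `ζ`. -/
theorem hasDerivAt_bessel_operator_primitive (α : ℕ) (w z ζ : ℝ) :
    HasDerivAt (fun ζ => -2 * w * (Real.sinh ζ ^ (2 * α + 1) *
        (-1 / (4 * ((α : ℝ) + 1)) * uBessel (α + 1) (kernelArg w z ζ))))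
      (z * kernelDeriv₂ α w z ζ + (2 * (α : ℝ) + 1) * kernelDeriv α w z ζ +
        z * kernel α w z ζ) ζ := by
  have hXζ : HasDerivAt (fun ζ => kernelArg w z ζ) (-(2 * z * w * Real.sinh ζ)) ζ :=
    ((Real.hasDerivAt_cosh ζ).const_mul (2 * z * w)).const_sub _
  have h := (((Real.hasDerivAt_sinh ζ).pow (2 * α + 1)).mul
    (((hasDerivAt_uBessel_succ α (kernelArg w z ζ)).comp ζ hXζ).const_mul
      (-1 / (4 * ((α : ℝ) + 1))))).const_mul (-2 * w)
  refine h.congr_deriv ?_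
  have hα1 : (α : ℝ) + 1 ≠ 0 := by positivity
  have hα2 : (α : ℝ) + 2 ≠ 0 := by positivity
  have hrec := uBessel_contiguity α (kernelArg w z ζ)
  have hsq : (2 * z - 2 * w * Real.cosh ζ) ^ 2 =
      4 * (kernelArg w z ζ + w ^ 2 * Real.sinh ζ ^ 2) := by
    rw [Real.sinh_sq]
    simp only [kernelArg]
    ring
  simp only [kernel, kernelDeriv, kernelDeriv₂, Nat.add_sub_cancel, Function.comp_apply,
    Pi.pow_apply]
  generalize kernelArg w z ζ = X at *
  generalize uBessel (α + 2) X = u₂ at *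
  generalize uBessel (α + 1) X = u₁ at *
  generalize uBessel α X = u at *
  push_cast
  set c₁ : ℝ := -1 / (4 * ((α : ℝ) + 2)) with hc₁
  set c₀ : ℝ := -1 / (4 * ((α : ℝ) + 1)) with hc₀
  have hode : 4 * X * (c₀ * (c₁ * u₂)) = -4 * ((α : ℝ) + 1) * (c₀ * u₁) - u := by
    rw [show 4 * X * (c₀ * (c₁ * u₂)) = 4 * c₀ * c₁ * (X * u₂) by ring, hrec, hc₀, hc₁]
    field_simp
  linear_combination (-z * Real.sinh ζ ^ (2 * α)) * hode -
    (z * c₀ * c₁ * u₂ * Real.sinh ζ ^ (2 * α)) * hsq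

theorem cosh_log_div {w z : ℝ} (hw : 0 < w) (hz : 0 < z) :
    Real.cosh (Real.log (z / w)) = (z ^ 2 + w ^ 2) / (2 * z * w) := by
  rw [Real.cosh_log (div_pos hz hw)]
  field_simp

theorem sinh_log_div {w z : ℝ} (hw : 0 < w) (hz : 0 < z) :
    Real.sinh (Real.log (z / w)) = (z ^ 2 - w ^ 2) / (2 * z * w) := by
  rw [Real.sinh_log (div_pos hz hw)]
  field_simp

theorem kernelArg_log_div {w z : ℝ} (hw : 0 < w) (hz : 0 < z) :
    kernelArg w z (Real.log (z / w)) = 0 := by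
  rw [kernelArg, cosh_log_div hw hz]
  field_simp
  ring

theorem hasDerivAt_log_div {w z : ℝ} (hw : 0 < w) (hz : 0 < z) :
    HasDerivAt (fun z => Real.log (z / w)) (1 / z) z := by
  have := ((hasDerivAt_id z).div_const w).log (div_pos hz hw).ne'
  exact this.congr_deriv (by simp; field_simp)

theorem hasDerivAt_sub_sq_div {w z : ℝ} (hw : 0 < w) (hz : 0 < z) :
    HasDerivAt (fun z => (z ^ 2 - w ^ 2) / (2 * z * w)) ((1 + w ^ 2 / z ^ 2) / (2 * w)) z := by
  have := ((hasDerivAt_pow 2 z).sub_const (w ^ 2)).div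
    (((hasDerivAt_id z).const_mul 2).mul_const w) (by simp; exact ⟨hz.ne', hw.ne'⟩)
  refine this.congr_deriv ?_
  simp
  field_simp
  ring

/-- The Bessel operator applied to `kernel` and integrated up to the endpoint `log (z / w)`. -/
theorem integral_bessel_operator (α : ℕ) {w z : ℝ} (hw : 0 < w) (hz : 0 < z) :
    z * (∫ ζ in (0 : ℝ)..Real.log (z / w), kernelDeriv₂ α w z ζ) +
      (2 * (α : ℝ) + 1) * (∫ ζ in (0 : ℝ)..Real.log (z / w), kernelDeriv α w z ζ) +
      z * (∫ ζ in (0 : ℝ)..Real.log (z / w), kernel α w z ζ) =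
    -2 * w * (((z ^ 2 - w ^ 2) / (2 * z * w)) ^ (2 * α + 1) * (-1 / (4 * ((α : ℝ) + 1)))) := by
  have c₀ : Continuous (kernel α w z) :=
    (continuous_kernel α w).uncurry_left z
  have c₁ : Continuous (kernelDeriv α w z) :=
    (continuous_kernelDeriv α w).uncurry_left z
  have c₂ : Continuous (kernelDeriv₂ α w z) :=
    (continuous_kernelDeriv₂ α w).uncurry_left z
  have i₀ := (c₀.intervalIntegrable (μ := MeasureTheory.volume) 0 (Real.log (z / w))).const_mul z
  have i₁ := (c₁.intervalIntegrable (μ := MeasureTheory.volume) 0 (Real.log (z / w))).const_mul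
    (2 * (α : ℝ) + 1)
  have i₂ := (c₂.intervalIntegrable (μ := MeasureTheory.volume) 0 (Real.log (z / w))).const_mul z
  have hftc := integral_eq_sub_of_hasDerivAt
    (fun ζ _ => hasDerivAt_bessel_operator_primitive α w z ζ) ((i₂.add i₁).add i₀)
  rw [integral_add (i₂.add i₁) i₀, integral_add i₂ i₁, integral_const_mul, integral_const_mul,
    integral_const_mul, sinh_log_div hw hz, kernelArg_log_div hw hz] at hftc
  rw [hftc]
  simp

theorem hasDerivAt_integral_kernel (α : ℕ) {w z : ℝ} (hw : 0 < w) (hz : 0 < z) :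
    HasDerivAt (fun z => ∫ ζ in (0 : ℝ)..Real.log (z / w), kernel α w z ζ)
      ((∫ ζ in (0 : ℝ)..Real.log (z / w), kernelDeriv α w z ζ) +
        ((z ^ 2 - w ^ 2) / (2 * z * w)) ^ (2 * α) * (1 / z)) z := by
  refine (hasDerivAt_integral_variable_limit (continuous_kernel α w) (continuous_kernelDeriv α w)
    (hasDerivAt_kernel α w) (hasDerivAt_log_div hw hz)).congr_deriv ?_
  rw [kernel, kernelArg_log_div hw hz, sinh_log_div hw hz, uBessel_zero, one_mul]

theorem hasDerivAt_integral_kernelDeriv (α : ℕ) {w z : ℝ} (hw : 0 < w) (hz : 0 < z) :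
    HasDerivAt (fun z => ∫ ζ in (0 : ℝ)..Real.log (z / w), kernelDeriv α w z ζ)
      ((∫ ζ in (0 : ℝ)..Real.log (z / w), kernelDeriv₂ α w z ζ) +
        -1 / (4 * ((α : ℝ) + 1)) * (2 * w) * ((z ^ 2 - w ^ 2) / (2 * z * w)) ^ (2 * α + 1) *
          (1 / z)) z := by
  refine (hasDerivAt_integral_variable_limit (continuous_kernelDeriv α w)
    (continuous_kernelDeriv₂ α w)
    (hasDerivAt_kernelDeriv α w) (hasDerivAt_log_div hw hz)).congr_deriv ?_
  have : 2 * z - 2 * w * ((z ^ 2 + w ^ 2) / (2 * z * w)) =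
      2 * w * ((z ^ 2 - w ^ 2) / (2 * z * w)) := by
    field_simp
    ring
  rw [kernelDeriv, kernelArg_log_div hw hz, sinh_log_div hw hz, cosh_log_div hw hz, uBessel_zero,
    this]
  ring

/-- **The inhomogeneous Bessel ODE for `ỹ`** (Lemma `L4.2`).
For fixed `w > 0`, the function
`ỹ(z) = ∫_0^{ln(z/w)} u_α(z² + w² - 2zw cosh ζ) sinh^{2α} ζ dζ`
is twice differentiable on `(0,∞)` and satisfies
`z ỹ'' + (2α+1) ỹ' + z ỹ = (α / (2^{2α-2} w^{2α})) ((z²-w²)/z)^{2α-1}`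
(for `α = 0` the right-hand side is `0`). -/
theorem ytilde_inhomogeneous_bessel_ode
    (α : ℕ) (w : ℝ) (hw : 0 < w)
    (ytilde : ℝ → ℝ)
    (hy : ∀ z : ℝ, ytilde z =
      ∫ ζ in (0 : ℝ)..Real.log (z / w),
        uBessel α (z ^ 2 + w ^ 2 - 2 * z * w * Real.cosh ζ) *
          Real.sinh ζ ^ (2 * α)) :
    (∀ z : ℝ, 0 < z →
      DifferentiableAt ℝ ytilde z ∧ DifferentiableAt ℝ (deriv ytilde) z) ∧
    ∀ z : ℝ, 0 < z →
      z * deriv (deriv ytilde) z + (2 * (α : ℝ) + 1) * deriv ytilde z + z * ytilde z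
        = ((α : ℝ) / ((2 : ℝ) ^ (2 * (α : ℤ) - 2) * w ^ (2 * α))) *
            ((z ^ 2 - w ^ 2) / z) ^ (2 * (α : ℤ) - 1) := by
  set s : ℝ → ℝ := fun z => (z ^ 2 - w ^ 2) / (2 * z * w) with hs
  have hyF : ytilde = fun z => ∫ ζ in (0 : ℝ)..Real.log (z / w), kernel α w z ζ := funext hy
  have hy₁ : ∀ z, 0 < z → HasDerivAt ytilde
      ((∫ ζ in (0 : ℝ)..Real.log (z / w), kernelDeriv α w z ζ) + s z ^ (2 * α) * (1 / z)) z := by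
    intro z hz
    rw [hyF]
    exact hasDerivAt_integral_kernel α hw hz
  have hy₂ : ∀ z, 0 < z → HasDerivAt (deriv ytilde)
      (((∫ ζ in (0 : ℝ)..Real.log (z / w), kernelDeriv₂ α w z ζ) +
        -1 / (4 * ((α : ℝ) + 1)) * (2 * w) * s z ^ (2 * α + 1) * (1 / z)) +
        (((2 * α : ℕ) : ℝ) * s z ^ (2 * α - 1) * ((1 + w ^ 2 / z ^ 2) / (2 * w)) * (1 / z) +
          s z ^ (2 * α) * (-1 / z ^ 2))) z := by
    intro z hz
    have hinv : HasDerivAt (fun z : ℝ => 1 / z) (-1 / z ^ 2) z := by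
      simpa [neg_div] using hasDerivAt_inv hz.ne'
    have hmain := (hasDerivAt_integral_kernelDeriv α hw hz).add
      (((hasDerivAt_sub_sq_div hw hz).pow (2 * α)).mul hinv)
    refine hmain.congr_of_eventuallyEq ?_
    filter_upwards [lt_mem_nhds hz] with x hx
    exact (hy₁ x hx).deriv
  refine ⟨fun z hz => ⟨(hy₁ z hz).differentiableAt, (hy₂ z hz).differentiableAt⟩, fun z hz => ?_⟩
  have hint := integral_bessel_operator α hw hz
  rw [(hy₂ z hz).deriv, (hy₁ z hz).deriv, hyF]
  have hsz : s z = (z ^ 2 - w ^ 2) / z / (2 * w) := by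
    simp only [hs]
    field_simp
  rw [show (z ^ 2 - w ^ 2) / (2 * z * w) = s z from rfl] at hint
  have hz0 := hz.ne'
  have hw0 := hw.ne'
  have hα0 : (α : ℝ) + 1 ≠ 0 := by positivity
  have hboundary : z * (((2 * α : ℕ) : ℝ) * s z ^ (2 * α - 1) *
      ((1 + w ^ 2 / z ^ 2) / (2 * w)) * (1 / z) + s z ^ (2 * α) * (-1 / z ^ 2)) +
      (2 * (α : ℝ) + 1) * (s z ^ (2 * α) * (1 / z)) =
      ((α : ℝ) / ((2 : ℝ) ^ (2 * (α : ℤ) - 2) * w ^ (2 * α))) *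
        ((z ^ 2 - w ^ 2) / z) ^ (2 * (α : ℤ) - 1) := by
    rcases α with _ | n
    · simp
      field_simp
      ring
    · rw [show 2 * ((n + 1 : ℕ) : ℤ) - 2 = ((2 * n : ℕ) : ℤ) by push_cast; ring,
        show 2 * ((n + 1 : ℕ) : ℤ) - 1 = ((2 * n + 1 : ℕ) : ℤ) by push_cast; ring,
        zpow_natCast, zpow_natCast, show 2 * (n + 1) - 1 = 2 * n + 1 by omega,
        show 2 * (n + 1) = 2 * n + 1 + 1 by ring, pow_succ (s z) (2 * n + 1)]
      have hA : (z ^ 2 - w ^ 2) / z = s z * (2 * w) := by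
        rw [hsz]
        field_simp
      rw [hA, mul_pow, mul_pow]
      generalize s z ^ (2 * n + 1) = P
      rw [hsz]
      push_cast
      field_simp
      ring
  have hcancel : z * (-1 / (4 * ((α : ℝ) + 1)) * (2 * w) * s z ^ (2 * α + 1) * (1 / z)) =
      -1 / (4 * ((α : ℝ) + 1)) * (2 * w) * s z ^ (2 * α + 1) := by
    field_simp
  linear_combination hint + hboundary + hcancel
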